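/- Let Γ̃ ⊂ Γ be nonempty sets of bounded measurable functions on X with α ≤ h ≤ β for all h ∈ Γ. Let 0 ≤ a < 1 < b ≤ ∞ and f ∈ F₁(a,b) be strictly convex in a neighborhood of 1 with z₀ + β − α in the interior of {f* < ∞}, where z₀ := f'_+(1). Then for any probability measures Q, P on X: 0 ≤ D_f^Γ(Q‖P) − D_f^{Γ̃}(Q‖P) ≤ (1 + (f*)'_+(z₀+β−α)) · sup_{h∈Γ} inf_{h̃∈Γ̃} ‖h − h̃‖_∞. -/

import Mathlib

open MeasureTheory Set Filter Topology
open scoped ENNReal NNReal Classical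

noncomputable section

/-- The interval `(a, b)` with `b` possibly infinite. -/
def Dom (a : ℝ) (b : EReal) : Set ℝ := {t : ℝ | a < t ∧ (t : EReal) < b}

/-- Legendre transform of `f` on `(a,b)`, with values in `(-∞, ∞]` (modeled by `EReal`). -/
def fStar (f : ℝ → ℝ) (a : ℝ) (b : EReal) (z : ℝ) : EReal :=
  ⨆ t ∈ Dom a b, ((z * t - f t : ℝ) : EReal)

/-- Real-valued version of the Legendre transform (junk value where it is `⊤`). -/
def fStarR (f : ℝ → ℝ) (a : ℝ) (b : EReal) (z : ℝ) : ℝ := (fStar f a b z).toReal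

/-- Right derivative of `g` at `z`. -/
def rderiv (g : ℝ → ℝ) (z : ℝ) : ℝ := derivWithin g (Ici z) z

/-- `z₀ := f'_+(1)`. -/
def zz (f : ℝ → ℝ) : ℝ := rderiv f 1

/-- Integral of an `EReal`-valued function: the Bochner integral if the function is
a.e. finite and integrable, and `⊤` otherwise. -/
def eIntegral {X : Type*} [MeasurableSpace X] (P : Measure X) (g : X → EReal) : EReal :=
  if (∀ᵐ x ∂P, g x ≠ ⊤) ∧ Integrable (fun x => (g x).toReal) P
  then ((∫ x, (g x).toReal ∂P : ℝ) : EReal) else ⊤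

/-- The generalized cumulant generating function `Λ_f^P[h]`. -/
def cgf {X : Type*} [MeasurableSpace X] (f : ℝ → ℝ) (a : ℝ) (b : EReal)
    (P : Measure X) (h : X → ℝ) : EReal :=
  ⨅ ν : ℝ, ((ν : EReal) + eIntegral P (fun x => fStar f a b (h x - ν)))

/-- Real-valued `Λ_f^P[h]`. -/
def cgfR {X : Type*} [MeasurableSpace X] (f : ℝ → ℝ) (a : ℝ) (b : EReal)
    (P : Measure X) (h : X → ℝ) : ℝ := (cgf f a b P h).toReal

/-- `Λ_f : ℝⁿ → ℝ` (with values in `EReal`). -/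
def lamVec (f : ℝ → ℝ) (a : ℝ) (b : EReal) {n : ℕ} (x : Fin n → ℝ) : EReal :=
  ⨅ ν : ℝ, ((ν : EReal) + ((n : ℝ)⁻¹ : EReal) * ∑ i, fStar f a b (x i - ν))

/-- Empirical measure of `n` points. -/
def empMeas {X : Type*} [MeasurableSpace X] (n : ℕ) (xs : Fin n → X) : Measure X :=
  (n : ℝ≥0∞)⁻¹ • ∑ i, Measure.dirac (xs i)

/-- The `(f,Γ)`-divergence `D_f^Γ(Q‖P)`. -/
def Dfg {X : Type*} [MeasurableSpace X] (f : ℝ → ℝ) (a : ℝ) (b : EReal)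
    (Γ : Set (X → ℝ)) (Q P : Measure X) : ℝ :=
  sSup {r : ℝ | ∃ h ∈ Γ, r = ∫ x, h x ∂Q - cgfR f a b P h}

/-- Empirical Rademacher complexity of `Ψ` at the sample `y`. -/
def empRad {Y : Type*} (Ψ : Set (Y → ℝ)) (n : ℕ) (y : Fin n → Y) : ℝ :=
  (2 ^ n : ℝ)⁻¹ * ∑ σ : Fin n → Bool,
    sSup {r : ℝ | ∃ ψ ∈ Ψ, r = (n : ℝ)⁻¹ * ∑ i, (if σ i then 1 else -1) * ψ (y i)}

/-- Rademacher complexity of `Ψ` relative to `P` with `n` samples. -/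
def rad {Y : Type*} [MeasurableSpace Y] (Ψ : Set (Y → ℝ)) (P : Measure Y) (n : ℕ) : ℝ :=
  ∫ y, empRad Ψ n y ∂(Measure.pi fun _ : Fin n => P)

/-- `Δ_{f,n}`. -/
def Δq (f : ℝ → ℝ) (a : ℝ) (b : EReal) (α β : ℝ) (n : ℕ) : ℝ :=
  sInf ((fun z => (n : ℝ) * (-z + (((n : ℝ) - 1) / (n : ℝ)) * fStarR f a b z
      + (1 / (n : ℝ)) * fStarR f a b (β - α + z))) '' Icc (zz f - (β - α)) (zz f))

/-- `sup_{h ∈ Γ} inf_{h̃ ∈ Γ̃} ‖h − h̃‖_∞`. -/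
def approxErr {X : Type*} (Γ Γt : Set (X → ℝ)) : ℝ :=
  sSup {r : ℝ | ∃ h ∈ Γ, r = sInf {s : ℝ | ∃ ht ∈ Γt, s = ⨆ x, |h x - ht x|}}

/-- A countable subset which is pointwise-limit dense. -/
def PtwiseDenseCount {X : Type*} (Γ : Set (X → ℝ)) : Prop :=
  ∃ Γ₀ ⊆ Γ, Γ₀.Countable ∧ ∀ h ∈ Γ, ∃ s : ℕ → X → ℝ,
    (∀ j, s j ∈ Γ₀) ∧ ∀ x, Tendsto (fun j => s j x) atTop (𝓝 (h x))

/-- The quantity `K_{f,Ψ,P,n}` from Definition 3.4: either `(f*)'_+` is Lipschitz on the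
relevant interval and `Ψ` contains a constant, in which case `K` is the minimum of the two
expressions, or `K` is the second expression. -/
def Kchoice (f : ℝ → ℝ) (a : ℝ) (b : EReal) (α β : ℝ) {Y : Type*} [MeasurableSpace Y]
    (Ψ : Set (Y → ℝ)) (P : Measure Y) (n : ℕ) (K : ℝ) : Prop :=
  (∃ L : ℝ≥0, LipschitzOnWith L (rderiv (fStarR f a b))
      (Icc (zz f - (β - α)) (zz f + (β - α))) ∧
    (∃ c : ℝ, (fun _ => c) ∈ Ψ) ∧
    K = min ((1 + 2 * (β - α) * (L : ℝ)) * rad Ψ P n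
        + (β - α) ^ 2 * (L : ℝ) / (2 * Real.sqrt n))
      (rderiv (fStarR f a b) (β - α + zz f) * (rad Ψ P n + (β - α) / (2 * Real.sqrt n))))
  ∨ K = rderiv (fStarR f a b) (β - α + zz f) * (rad Ψ P n + (β - α) / (2 * Real.sqrt n))

/-- Covering number of a (pseudo)metric space by `ε`-balls. -/
def coverNum (Θ : Type*) [PseudoMetricSpace Θ] (ε : ℝ) : ℝ≥0∞ :=
  ⨅ s ∈ {s : Finset Θ | ∀ θ : Θ, ∃ c ∈ s, dist θ c ≤ ε}, ((s.card : ℝ≥0∞))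

end

/-- Supporting line of a convex function at an interior point, with the right derivative as
slope. -/
lemma ConvexOn.add_rderiv_mul_sub_le {S : Set ℝ} {f : ℝ → ℝ} (hf : ConvexOn ℝ S f) {x y : ℝ}
    (hx : x ∈ interior S) (hy : y ∈ S) : f x + rderiv f x * (y - x) ≤ f y := by
  rw [rderiv, ← derivWithin_Ioi_eq_Ici]
  rcases lt_trichotomy x y with h | rfl | h
  · have := hf.rightDeriv_le_slope_of_mem_interior hx hy h
    rw [slope_def_field, le_div_iff₀ (sub_pos.2 h)] at this
    linarith
  · simp
  · have := (hf.slope_le_leftDeriv_of_mem_interior hy hx h).trans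
      (hf.leftDeriv_le_rightDeriv_of_mem_interior hx)
    rw [slope_def_field, div_le_iff₀ (sub_pos.2 h)] at this
    linarith

lemma isOpen_Dom (a : ℝ) (b : EReal) : IsOpen (Dom a b) :=
  (isOpen_lt continuous_const continuous_id).inter
    (isOpen_lt continuous_coe_real_ereal continuous_const)

section LegendreTransform

variable {f : ℝ → ℝ} {a : ℝ} {b : EReal}

lemma le_fStar {t : ℝ} (ht : t ∈ Dom a b) (z : ℝ) :
    ((z * t - f t : ℝ) : EReal) ≤ fStar f a b z :=
  le_iSup₂ (f := fun t (_ : t ∈ Dom a b) => ((z * t - f t : ℝ) : EReal)) t ht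

lemma monotone_fStar (ha : 0 ≤ a) : Monotone (fStar f a b) := by
  intro y z hyz
  refine iSup₂_mono fun t ht => EReal.coe_le_coe_iff.2 ?_
  have : 0 ≤ t := ha.trans ht.1.le
  nlinarith

lemma self_le_fStar (h1 : 1 ∈ Dom a b) (hf1 : f 1 = 0) (z : ℝ) : (z : EReal) ≤ fStar f a b z := by
  simpa [hf1] using le_fStar (f := f) h1 z

lemma coe_fStarR (h1 : 1 ∈ Dom a b) {z : ℝ} (hz : fStar f a b z < ⊤) :
    (fStarR f a b z : EReal) = fStar f a b z :=
  EReal.coe_toReal hz.ne ((EReal.bot_lt_coe _).trans_le (le_fStar h1 z)).ne'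

lemma self_le_fStarR (h1 : 1 ∈ Dom a b) (hf1 : f 1 = 0) {z : ℝ} (hz : fStar f a b z < ⊤) :
    z ≤ fStarR f a b z := by
  rw [← EReal.coe_le_coe_iff, coe_fStarR h1 hz]
  exact self_le_fStar h1 hf1 z

lemma convexOn_fStarR (h1 : 1 ∈ Dom a b) :
    ConvexOn ℝ {z : ℝ | fStar f a b z < ⊤} (fStarR f a b) := by
  have key : ∀ x ∈ {z : ℝ | fStar f a b z < ⊤}, ∀ y ∈ {z : ℝ | fStar f a b z < ⊤}, ∀ p q : ℝ,
      0 ≤ p → 0 ≤ q → p + q = 1 →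
      fStar f a b (p • x + q • y) ≤ ((p • fStarR f a b x + q • fStarR f a b y : ℝ) : EReal) := by
    intro x hx y hy p q hp hq hpq
    refine iSup₂_le fun t ht => EReal.coe_le_coe_iff.2 ?_
    have hxt := le_fStar (f := f) ht x
    have hyt := le_fStar (f := f) ht y
    rw [← coe_fStarR h1 hx, EReal.coe_le_coe_iff] at hxt
    rw [← coe_fStarR h1 hy, EReal.coe_le_coe_iff] at hyt
    calc (p • x + q • y) * t - f t = p * (x * t - f t) + q * (y * t - f t) := by
          simp only [smul_eq_mul]
          linear_combination f t * hpq
      _ ≤ _ := by simp only [smul_eq_mul]; gcongr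
  refine ⟨fun x hx y hy p q hp hq hpq => (key x hx y hy p q hp hq hpq).trans_lt
    (EReal.coe_lt_top _), fun x hx y hy p q hp hq hpq => ?_⟩
  have h := key x hx y hy p q hp hq hpq
  rwa [← coe_fStarR h1 (h.trans_lt (EReal.coe_lt_top _)), EReal.coe_le_coe_iff] at h

lemma fStarR_le_fStarR (ha : 0 ≤ a) (h1 : 1 ∈ Dom a b) {y z : ℝ} (hyz : y ≤ z)
    (hz : fStar f a b z < ⊤) : fStarR f a b y ≤ fStarR f a b z := by
  have h := monotone_fStar (f := f) (b := b) ha hyz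
  rwa [← coe_fStarR h1 (h.trans_lt hz), ← coe_fStarR h1 hz, EReal.coe_le_coe_iff] at h

lemma fStar_zz (h1 : 1 ∈ Dom a b) (hconv : ConvexOn ℝ (Dom a b) f) (hf1 : f 1 = 0) :
    fStar f a b (zz f) = zz f := by
  refine le_antisymm (iSup₂_le fun t ht => EReal.coe_le_coe_iff.2 ?_) (self_le_fStar h1 hf1 _)
  have := hconv.add_rderiv_mul_sub_le ((isOpen_Dom a b).interior_eq.symm ▸ h1) ht
  rw [hf1] at this
  change 0 + zz f * (t - 1) ≤ f t at this
  linarith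

lemma sub_le_fStarR_sub (ha : 0 ≤ a) (h1 : 1 ∈ Dom a b) (hconv : ConvexOn ℝ (Dom a b) f)
    (hf1 : f 1 = 0) {x y : ℝ} (hx : zz f ≤ x) (hxy : x ≤ y) (hy : fStar f a b y < ⊤) :
    y - x ≤ fStarR f a b y - fStarR f a b x := by
  have hz : fStarR f a b (zz f) = zz f := by rw [fStarR, fStar_zz h1 hconv hf1, EReal.toReal_coe]
  rcases hxy.eq_or_lt with rfl | hxy
  · simp
  rcases hx.eq_or_lt with rfl | hx
  · have := self_le_fStarR h1 hf1 hy
    linarith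
  have hxS := (monotone_fStar ha hxy.le).trans_lt hy
  have hs := (convexOn_fStarR h1).slope_mono_adjacent
    ((monotone_fStar ha hx.le).trans_lt hxS) hy hx hxy
  have h1s : 1 ≤ (fStarR f a b x - fStarR f a b (zz f)) / (x - zz f) := by
    rw [le_div_iff₀ (sub_pos.2 hx), hz]
    have := self_le_fStarR h1 hf1 hxS
    linarith
  have := h1s.trans hs
  rw [le_div_iff₀ (sub_pos.2 hxy)] at this
  linarith

lemma rderiv_fStarR_nonneg (ha : 0 ≤ a) (h1 : 1 ∈ Dom a b) {w : ℝ}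
    (hw : w ∈ interior {z : ℝ | fStar f a b z < ⊤}) : 0 ≤ rderiv (fStarR f a b) w := by
  have hle : w - 1 ≤ w := by linarith
  have hwS := interior_subset hw
  have := (convexOn_fStarR h1).add_rderiv_mul_sub_le hw
    ((monotone_fStar ha hle).trans_lt hwS : w - 1 ∈ _)
  have := fStarR_le_fStarR ha h1 hle hwS
  linarith

lemma fStarR_le_add_rderiv_mul_abs (ha : 0 ≤ a) (h1 : 1 ∈ Dom a b) {w : ℝ}
    (hw : w ∈ interior {z : ℝ | fStar f a b z < ⊤}) {x y : ℝ} (hx : x ≤ w) (hy : y ≤ w) :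
    fStarR f a b y ≤ fStarR f a b x + rderiv (fStarR f a b) w * |y - x| := by
  have hK := rderiv_fStarR_nonneg ha h1 hw
  have hwS : fStar f a b w < ⊤ := (interior_subset hw : w ∈ {z : ℝ | _})
  have hxS := (monotone_fStar ha hx).trans_lt hwS
  rcases le_total y x with h | h
  · have := fStarR_le_fStarR ha h1 h hxS
    have := mul_nonneg hK (abs_nonneg (y - x))
    linarith
  have hyI : y ∈ interior {z : ℝ | fStar f a b z < ⊤} := by
    rcases hy.eq_or_lt with rfl | hy
    · exact hw
    · exact interior_maximal (fun z hz => (monotone_fStar ha (le_of_lt hz)).trans_lt hwS)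
        isOpen_Iio hy
  have hsupp := (convexOn_fStarR h1).add_rderiv_mul_sub_le hyI hxS
  have hmono := (convexOn_fStarR (f := f) h1).monotoneOn_rightDeriv hyI hw hy
  simp only [derivWithin_Ioi_eq_Ici] at hmono
  change rderiv _ y ≤ rderiv _ w at hmono
  rw [abs_of_nonneg (sub_nonneg.2 h)]
  nlinarith [sub_nonneg.2 h]

end LegendreTransform

section CumulantGeneratingFunction

variable {X : Type*} [MeasurableSpace X] {f : ℝ → ℝ} {a : ℝ} {b : EReal} {P : Measure X}

lemma cgf_le (ν : ℝ) (h : X → ℝ) :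
    cgf f a b P h ≤ ν + eIntegral P (fun x => fStar f a b (h x - ν)) := iInf_le _ ν

lemma integral_le_cgf [IsProbabilityMeasure P] (h1 : 1 ∈ Dom a b) (hf1 : f 1 = 0) {h : X → ℝ}
    (hh : Integrable h P) : ((∫ x, h x ∂P : ℝ) : EReal) ≤ cgf f a b P h := by
  refine le_iInf fun ν => ?_
  unfold eIntegral
  split_ifs with hc
  · rw [← EReal.coe_add, EReal.coe_le_coe_iff]
    have hle : ∫ x, (h x - ν) ∂P ≤ ∫ x, (fStar f a b (h x - ν)).toReal ∂P := by
      refine integral_mono_ae (hh.sub (integrable_const ν)) hc.2 ?_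
      filter_upwards [hc.1] with x hx
      exact self_le_fStarR h1 hf1 (lt_top_iff_ne_top.2 hx)
    rw [integral_sub hh (integrable_const ν)] at hle
    simp at hle
    linarith
  · simp

variable [IsProbabilityMeasure P]

lemma integrable_fStarR_comp (ha : 0 ≤ a) (h1 : 1 ∈ Dom a b) (hf1 : f 1 = 0) {w : ℝ}
    (hw : fStar f a b w < ⊤) {k : X → ℝ} (hk : Measurable k) {m : ℝ} (hkm : ∀ x, m ≤ k x)
    (hkw : ∀ x, k x ≤ w) : Integrable (fun x => fStarR f a b (k x)) P := by
  refine Integrable.of_mem_Icc m (fStarR f a b w) ?_ (.of_forall fun x => ⟨?_, ?_⟩)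
  · exact (((monotone_fStar ha).measurable.comp hk).ereal_toReal).aemeasurable
  · exact (hkm x).trans (self_le_fStarR h1 hf1 ((monotone_fStar ha (hkw x)).trans_lt hw))
  · exact fStarR_le_fStarR ha h1 (hkw x) hw

lemma eIntegral_fStar_comp (ha : 0 ≤ a) (h1 : 1 ∈ Dom a b) (hf1 : f 1 = 0) {w : ℝ}
    (hw : fStar f a b w < ⊤) {k : X → ℝ} (hk : Measurable k) {m : ℝ} (hkm : ∀ x, m ≤ k x)
    (hkw : ∀ x, k x ≤ w) :
    eIntegral P (fun x => fStar f a b (k x)) = ((∫ x, fStarR f a b (k x) ∂P : ℝ) : EReal) :=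
  if_pos ⟨.of_forall fun x => ((monotone_fStar ha (hkw x)).trans_lt hw).ne,
    integrable_fStarR_comp ha h1 hf1 hw hk hkm hkw⟩

/-- Lipschitz estimate for the cumulant generating function: the infimum over `ν` may be
restricted to `α - zz f ≤ ν`, where the Legendre transform has the stated Lipschitz constant. -/
lemma cgf_le_cgf_add (ha : 0 ≤ a) (h1 : 1 ∈ Dom a b) (hconv : ConvexOn ℝ (Dom a b) f)
    (hf1 : f 1 = 0) {α β : ℝ} (hz : zz f + β - α ∈ interior {z : ℝ | fStar f a b z < ⊤})
    {h k : X → ℝ} (hh : Measurable h) (hk : Measurable k) (hhb : ∀ x, h x ∈ Icc α β)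
    (hkb : ∀ x, k x ∈ Icc α β) {s : ℝ} (hs : ∀ x, |h x - k x| ≤ s) :
    cgf f a b P h ≤ cgf f a b P k + ((rderiv (fStarR f a b) (zz f + β - α) * s : ℝ) : EReal) := by
  have hzS : fStar f a b (zz f + β - α) < ⊤ := (interior_subset hz : _ ∈ {z : ℝ | _})
  have hK := rderiv_fStarR_nonneg ha h1 hz
  rw [← EReal.sub_le_iff_le_add (.inl (EReal.coe_ne_bot _)) (.inl (EReal.coe_ne_top _))]
  refine le_iInf fun ν => ?_
  rw [EReal.sub_le_iff_le_add (.inl (EReal.coe_ne_bot _)) (.inl (EReal.coe_ne_top _))]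
  have hInt : ∀ {l : X → ℝ}, Measurable l → (∀ x, l x ∈ Icc α β) →
      Integrable (fun x => fStarR f a b (l x - max ν (α - zz f))) P := fun hl hlb =>
    integrable_fStarR_comp ha h1 hf1 hzS (hl.sub_const _)
      (fun x => sub_le_sub_right (hlb x).1 _)
      (fun x => by linarith [(hlb x).2, le_max_right ν (α - zz f)])
  by_cases hc : (∀ᵐ x ∂P, fStar f a b (k x - ν) ≠ ⊤) ∧
      Integrable (fun x => (fStar f a b (k x - ν)).toReal) P
  swap
  · rw [eIntegral, if_neg hc, EReal.coe_add_top, EReal.top_add_coe]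
    exact le_top
  refine (cgf_le (max ν (α - zz f)) h).trans ?_
  rw [eIntegral_fStar_comp ha h1 hf1 hzS (hh.sub_const _)
      (fun x => sub_le_sub_right (hhb x).1 _)
      (fun x => by linarith [(hhb x).2, le_max_right ν (α - zz f)]), eIntegral, if_pos hc]
  norm_cast
  have hlip : ∫ x, fStarR f a b (h x - max ν (α - zz f)) ∂P ≤
      ∫ x, (fStarR f a b (k x - max ν (α - zz f))
        + rderiv (fStarR f a b) (zz f + β - α) * s) ∂P := by
    refine integral_mono (hInt hh hhb) ((hInt hk hkb).add (integrable_const _)) fun x => ?_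
    refine (fStarR_le_add_rderiv_mul_abs ha h1 hz (x := k x - max ν (α - zz f))
      (by linarith [(hkb x).2, le_max_right ν (α - zz f)])
      (by linarith [(hhb x).2, le_max_right ν (α - zz f)])).trans ?_
    rw [sub_sub_sub_cancel_right]
    gcongr
    exact hs x
  have hshift : ∫ x, (fStarR f a b (k x - max ν (α - zz f)) + (max ν (α - zz f) - ν)) ∂P ≤
      ∫ x, (fStar f a b (k x - ν)).toReal ∂P := by
    refine integral_mono_ae ((hInt hk hkb).add (integrable_const _)) hc.2 ?_
    filter_upwards [hc.1] with x hx
    change _ ≤ fStarR f a b (k x - ν)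
    rcases le_total (α - zz f) ν with hν | hν
    · simp [max_eq_left hν]
    · rw [max_eq_right hν]
      have := sub_le_fStarR_sub ha h1 hconv hf1 (x := k x - (α - zz f)) (y := k x - ν)
        (by linarith [(hkb x).1]) (by linarith) (lt_top_iff_ne_top.2 hx)
      linarith
  rw [integral_add (hInt hk hkb) (integrable_const _)] at hlip hshift
  simp only [integral_const, probReal_univ, one_smul] at hlip hshift
  linarith

lemma coe_cgfR (ha : 0 ≤ a) (h1 : 1 ∈ Dom a b) (hf1 : f 1 = 0) {α β : ℝ}
    (hz : fStar f a b (zz f + β - α) < ⊤) {h : X → ℝ} (hh : Measurable h)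
    (hhb : ∀ x, h x ∈ Icc α β) : (cgfR f a b P h : EReal) = cgf f a b P h := by
  refine EReal.coe_toReal (ne_of_lt ?_) (ne_of_gt ?_)
  · refine (cgf_le (α - zz f) h).trans_lt ?_
    rw [eIntegral_fStar_comp ha h1 hf1 hz (hh.sub_const _)
      (fun x => sub_le_sub_right (hhb x).1 _) (fun x => by linarith [(hhb x).2]),
      ← EReal.coe_add]
    exact EReal.coe_lt_top _
  · exact (EReal.bot_lt_coe _).trans_le (integral_le_cgf h1 hf1
      (Integrable.of_mem_Icc α β hh.aemeasurable (.of_forall hhb)))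

end CumulantGeneratingFunction

/-- Discriminator approximation error bound for `(f,Γ)`-divergences. -/
theorem stmt8 {X : Type*} [MeasurableSpace X]
    (Γt Γ : Set (X → ℝ)) (hsub : Γt ⊆ Γ) (hΓtne : Γt.Nonempty)
    (hmeas : ∀ h ∈ Γ, Measurable h) (α β : ℝ) (hbd : ∀ h ∈ Γ, ∀ x, h x ∈ Set.Icc α β)
    (f : ℝ → ℝ) (a : ℝ) (b : EReal)
    (ha0 : 0 ≤ a) (ha1 : a < 1) (hb1 : ((1 : ℝ) : EReal) < b)
    (hconv : ConvexOn ℝ (Dom a b) f) (hf1 : f 1 = 0)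
    (hstrict : ∃ ε > 0, Set.Ioo (1 - ε) (1 + ε) ⊆ Dom a b ∧
      StrictConvexOn ℝ (Set.Ioo (1 - ε) (1 + ε)) f)
    (hz : zz f + β - α ∈ interior {z : ℝ | fStar f a b z < ⊤})
    (Q P : MeasureTheory.Measure X)
    [MeasureTheory.IsProbabilityMeasure Q] [MeasureTheory.IsProbabilityMeasure P] :
    0 ≤ Dfg f a b Γ Q P - Dfg f a b Γt Q P ∧
      Dfg f a b Γ Q P - Dfg f a b Γt Q P ≤
        (1 + rderiv (fStarR f a b) (zz f + β - α)) * approxErr Γ Γt := by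
  have h1 : (1 : ℝ) ∈ Dom a b := ⟨ha1, hb1⟩
  have hzS : fStar f a b (zz f + β - α) < ⊤ := (interior_subset hz : _ ∈ {z : ℝ | _})
  have hK := rderiv_fStarR_nonneg ha0 h1 hz
  have hInt : ∀ (μ : Measure X) [IsProbabilityMeasure μ], ∀ h ∈ Γ, Integrable h μ :=
    fun μ _ h hh => .of_mem_Icc α β (hmeas h hh).aemeasurable (.of_forall (hbd h hh))
  have hbddX : ∀ h ∈ Γ, ∀ k ∈ Γ, ∀ x, |h x - k x| ≤ β - α := fun h hh k hk x =>
    abs_le.2 ⟨by linarith [(hbd h hh x).1, (hbd k hk x).2],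
      by linarith [(hbd h hh x).2, (hbd k hk x).1]⟩
  have : Nonempty X := nonempty_of_isProbabilityMeasure P
  have hbddD : BddAbove {r : ℝ | ∃ h ∈ Γ, r = ∫ x, h x ∂Q - cgfR f a b P h} := by
    refine ⟨β - α, ?_⟩
    rintro _ ⟨h, hh, rfl⟩
    have hQ : ∫ x, h x ∂Q ≤ ∫ _, β ∂Q :=
      integral_mono (hInt Q h hh) (integrable_const _) fun x => (hbd h hh x).2
    have hP : ∫ _, α ∂P ≤ ∫ x, h x ∂P :=
      integral_mono (integrable_const _) (hInt P h hh) fun x => (hbd h hh x).1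
    have hc := integral_le_cgf (a := a) (b := b) h1 hf1 (hInt P h hh)
    rw [← coe_cgfR ha0 h1 hf1 hzS (hmeas h hh) (hbd h hh), EReal.coe_le_coe_iff] at hc
    simp only [integral_const, probReal_univ, one_smul] at hQ hP
    linarith
  have hsubD : {r : ℝ | ∃ h ∈ Γt, r = ∫ x, h x ∂Q - cgfR f a b P h} ⊆
      {r : ℝ | ∃ h ∈ Γ, r = ∫ x, h x ∂Q - cgfR f a b P h} :=
    fun _ ⟨h, hh, e⟩ => ⟨h, hsub hh, e⟩
  obtain ⟨k₀, hk₀⟩ := hΓtne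
  constructor
  · exact sub_nonneg.2 (csSup_le_csSup hbddD ⟨_, k₀, hk₀, rfl⟩ hsubD)
  have hbelow : ∀ h : X → ℝ, BddBelow {s : ℝ | ∃ k ∈ Γt, s = ⨆ x, |h x - k x|} := by
    refine fun h => ⟨0, ?_⟩
    rintro _ ⟨k, -, rfl⟩
    exact Real.iSup_nonneg fun x => abs_nonneg _
  rw [sub_le_iff_le_add]
  refine csSup_le ⟨_, k₀, hsub hk₀, rfl⟩ ?_
  rintro _ ⟨h, hh, rfl⟩
  have hinf : sInf {s : ℝ | ∃ k ∈ Γt, s = ⨆ x, |h x - k x|} ≤ approxErr Γ Γt := by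
    refine le_csSup ⟨β - α, ?_⟩ ⟨h, hh, rfl⟩
    rintro _ ⟨h', hh', rfl⟩
    exact (csInf_le (hbelow h') ⟨k₀, hk₀, rfl⟩).trans
      (ciSup_le (hbddX h' hh' k₀ (hsub hk₀)))
  rw [← sub_le_iff_le_add, ← div_le_iff₀' (by linarith)]
  refine hinf.trans' (le_csInf ⟨_, k₀, hk₀, rfl⟩ ?_)
  rintro _ ⟨k, hk, rfl⟩
  rw [div_le_iff₀' (by linarith), sub_le_iff_le_add]
  have hkΓ := hsub hk
  have hs : ∀ x, |h x - k x| ≤ ⨆ x, |h x - k x| :=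
    le_ciSup ⟨β - α, forall_mem_range.2 (hbddX h hh k hkΓ)⟩
  have hD : ∫ x, k x ∂Q - cgfR f a b P k ≤ Dfg f a b Γt Q P :=
    le_csSup (hbddD.mono hsubD) ⟨k, hk, rfl⟩
  have hQ : ∫ x, h x ∂Q ≤ ∫ x, (k x + ⨆ x, |h x - k x|) ∂Q :=
    integral_mono (hInt Q h hh) ((hInt Q k hkΓ).add (integrable_const _)) fun x => by
      linarith [le_abs_self (h x - k x), hs x]
  rw [integral_add (hInt Q k hkΓ) (integrable_const _)] at hQ
  simp only [integral_const, probReal_univ, one_smul] at hQ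
  have hc := cgf_le_cgf_add (P := P) ha0 h1 hconv hf1 hz (hmeas k hkΓ) (hmeas h hh)
    (hbd k hkΓ) (hbd h hh) (fun x => (abs_sub_comm _ _).trans_le (hs x))
  rw [← coe_cgfR ha0 h1 hf1 hzS (hmeas h hh) (hbd h hh),
    ← coe_cgfR ha0 h1 hf1 hzS (hmeas k hkΓ) (hbd k hkΓ), ← EReal.coe_add,
    EReal.coe_le_coe_iff] at hc
  linarith
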